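/- For every s > 0 and every nonzero vector v ∈ ℂ^{n−1}×{0} ⊆ ℂⁿ, there exist maps f, g : Δ̄ → ℂⁿ, continuous on Δ̄ and C¹ on Δ, satisfying the interior equations (★) on Δ and the boundary conditions (B1), (B2) on ∂Δ with ζ̄·gₙ(ζ) ∈ ℝ∖{0} for all ζ ∈ ∂Δ, and such that f(0) = (0,…,0,s) and ∂f/∂x(0) = c·v for some c ∈ ℝ∖{0}. In other words, through every point of the inward real normal axis of Γ⁰ and tangent to every direction in the span of the first n−1 complex coordinate directions, there passes a stationary disc of Γ⁰ for the osculating structure J⁰. -/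

import Mathlib

open Complex ComplexConjugate Finset

noncomputable section

/-- Wirtinger derivative `∂F/∂ζ` of a scalar function. -/
def wderC (F : ℂ → ℂ) (ζ : ℂ) : ℂ :=
  (2⁻¹ : ℂ) * (fderiv ℝ F ζ 1 - Complex.I * fderiv ℝ F ζ Complex.I)

/-- Wirtinger derivative `∂F/∂ζ̄` of a scalar function. -/
def wbarC (F : ℂ → ℂ) (ζ : ℂ) : ℂ :=
  (2⁻¹ : ℂ) * (fderiv ℝ F ζ 1 + Complex.I * fderiv ℝ F ζ Complex.I)

/-- The interior equations (★) of the stationary-disc system for `(J⁰, Γ⁰)` at `ζ`. -/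
def starSystem (n : ℕ) (A : Fin n → Fin n → ℂ)
    (f g : ℂ → Fin (n+1) → ℂ) (ζ : ℂ) : Prop :=
  (∀ α : Fin n, wbarC (fun ζ' => f ζ' α.castSucc) ζ = 0) ∧
  (wbarC (fun ζ' => f ζ' (Fin.last n)) ζ -
    (Complex.I / 2) * ∑ α : Fin n, ∑ β : Fin n,
      A α β * conj (f ζ β.castSucc) * conj (wderC (fun ζ' => f ζ' α.castSucc) ζ) = 0) ∧
  (∀ α : Fin n, wbarC (fun ζ' => g ζ' α.castSucc) ζ +
    (Complex.I / 2) * ∑ β : Fin n,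
      conj (A α β) * f ζ β.castSucc *
        conj (wderC (fun ζ' => g ζ' (Fin.last n)) ζ) = 0) ∧
  wbarC (fun ζ' => g ζ' (Fin.last n)) ζ = 0

/-- The boundary conditions (B1), (B2) of the stationary-disc system at `ζ ∈ ∂Δ`. -/
def bdrySystem (n : ℕ) (A : Fin n → Fin n → ℂ)
    (f g : ℂ → Fin (n+1) → ℂ) (ζ : ℂ) : Prop :=
  (2 * (f ζ (Fin.last n)).re = ∑ α : Fin n, Complex.normSq (f ζ α.castSucc)) ∧
  (∀ α : Fin n,
    g ζ α.castSucc +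
      (conj (f ζ α.castSucc) +
        (Complex.I / 2) * ∑ β : Fin n, conj (A α β) * f ζ β.castSucc) *
        g ζ (Fin.last n) -
      (Complex.I / 2) * (∑ β : Fin n, conj (A α β) * f ζ β.castSucc) *
        conj (g ζ (Fin.last n)) = 0) ∧
  conj ζ * g ζ (Fin.last n) = ζ * conj (g ζ (Fin.last n))

theorem hasFDerivAt_mul_conj_add_sq (a b d ζ : ℂ) :
    HasFDerivAt (𝕜 := ℝ) (fun z : ℂ => a * (z * conj z) + b * z ^ 2 + d)
      (a • (ζ • (conjCLE : ℂ →L[ℝ] ℂ) + conj ζ • ContinuousLinearMap.id ℝ ℂ) +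
        b • ((2 * ζ) • ContinuousLinearMap.id ℝ ℂ)) ζ := by
  have h1 : HasFDerivAt (𝕜 := ℝ) (fun z : ℂ => z) (ContinuousLinearMap.id ℝ ℂ) ζ :=
    hasFDerivAt_id ζ
  have h2 : HasFDerivAt (𝕜 := ℝ) (fun z : ℂ => conj z) (conjCLE : ℂ →L[ℝ] ℂ) ζ :=
    conjCLE.hasFDerivAt
  have h3 := h1.pow 2
  norm_num at h3
  exact ((((h1.mul h2).const_mul a).add (h3.const_mul b)).add_const d)

theorem wbarC_mul_conj_add_sq (a b d ζ : ℂ) :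
    wbarC (fun z : ℂ => a * (z * conj z) + b * z ^ 2 + d) ζ = a * ζ := by
  rw [wbarC, (hasFDerivAt_mul_conj_add_sq a b d ζ).fderiv]
  simp
  ring_nf
  simp
  ring

theorem hasFDerivAt_mul_const_add (a d ζ : ℂ) :
    HasFDerivAt (𝕜 := ℝ) (fun z : ℂ => z * a + d) (a • ContinuousLinearMap.id ℝ ℂ) ζ :=
  ((hasFDerivAt_id (𝕜 := ℝ) ζ).mul_const' a).add_const d |>.congr_fderiv (by ext; simp)

theorem wbarC_mul_const_add (a d ζ : ℂ) : wbarC (fun z : ℂ => z * a + d) ζ = 0 := by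
  rw [wbarC, (hasFDerivAt_mul_const_add a d ζ).fderiv]
  simp
  linear_combination a * I_mul_I

theorem wderC_mul_const_add (a d ζ : ℂ) : wderC (fun z : ℂ => z * a + d) ζ = a := by
  rw [wderC, (hasFDerivAt_mul_const_add a d ζ).fderiv]
  simp
  linear_combination -(1 / 2) * a * I_mul_I

/-- An antisymmetric bilinear form vanishes on the diagonal. -/
theorem sum_antisymm_mul_mul_eq_zero {ι : Type*} [Fintype ι] (A : ι → ι → ℂ)
    (hA : ∀ α β, A α β = -A β α) (w : ι → ℂ) :
    ∑ α, ∑ β, A α β * w β * w α = 0 := by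
  have h : ∑ α, ∑ β, A α β * w β * w α = -∑ α, ∑ β, A α β * w β * w α := by
    conv_lhs => rw [Finset.sum_comm]
    simp only [← Finset.sum_neg_distrib]
    refine Finset.sum_congr rfl fun α _ => Finset.sum_congr rfl fun β _ => ?_
    rw [hA β α]
    ring
  exact self_eq_neg.mp h

theorem exists_ne_zero_mul_sum_normSq_eq {n : ℕ} {s : ℝ} (hs : 0 < s) {v : Fin (n + 1) → ℂ}
    (hv : v ≠ 0) (hvtan : v (Fin.last n) = 0) :
    ∃ c : ℝ, c ≠ 0 ∧ c ^ 2 * ∑ α : Fin n, normSq (v α.castSucc) = 2 * s := by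
  have hpos : 0 < ∑ α : Fin n, normSq (v α.castSucc) := by
    refine Finset.sum_pos' (fun α _ => normSq_nonneg _) ?_
    by_contra! h
    refine hv (funext fun i => ?_)
    cases i using Fin.lastCases with
    | last => exact hvtan
    | cast α => exact normSq_eq_zero.mp (le_antisymm (h α (mem_univ α)) (normSq_nonneg _))
  refine ⟨√(2 * s / ∑ α : Fin n, normSq (v α.castSucc)), by positivity, ?_⟩
  rw [Real.sq_sqrt (by positivity), div_mul_cancel₀ _ hpos.ne']

/-- The linear disc `ζ ↦ (ζ u, s)`. -/
def linearDisc {n : ℕ} (u : Fin n → ℂ) (s : ℂ) (ζ : ℂ) : Fin (n + 1) → ℂ :=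
  Fin.snoc (fun α => ζ * u α + 0) (ζ * 0 + s)

/-- A conormal lift of `linearDisc u s` whose last component is `ζ`. -/
def linearDiscLift {n : ℕ} (A : Fin n → Fin n → ℂ) (u : Fin n → ℂ) (ζ : ℂ) : Fin (n + 1) → ℂ :=
  Fin.snoc
    (fun α => -(I / 2 * ∑ β, conj (A α β) * u β) * (ζ * conj ζ) +
      -(I / 2 * ∑ β, conj (A α β) * u β) * ζ ^ 2 +
      (I * ∑ β, conj (A α β) * u β - conj (u α)))
    (ζ * 1 + 0)

theorem contDiff_linearDisc {n : ℕ} (u : Fin n → ℂ) (s : ℂ) :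
    ContDiff ℝ 1 (linearDisc u s) := by
  refine contDiff_pi.mpr fun i => ?_
  cases i using Fin.lastCases <;> simp only [linearDisc, Fin.snoc_last, Fin.snoc_castSucc] <;>
    fun_prop

theorem contDiff_linearDiscLift {n : ℕ} (A : Fin n → Fin n → ℂ) (u : Fin n → ℂ) :
    ContDiff ℝ 1 (linearDiscLift A u) := by
  have hconj : ContDiff ℝ 1 (fun z : ℂ => conj z) := conjCLE.contDiff
  refine contDiff_pi.mpr fun i => ?_
  cases i using Fin.lastCases <;>
    simp only [linearDiscLift, Fin.snoc_last, Fin.snoc_castSucc] <;> fun_prop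

theorem starSystem_linearDisc {n : ℕ} (A : Fin n → Fin n → ℂ)
    (hA : ∀ α β, A α β = -A β α) (u : Fin n → ℂ) (s ζ : ℂ) :
    starSystem n A (linearDisc u s) (linearDiscLift A u) ζ := by
  simp only [starSystem, linearDisc, linearDiscLift, Fin.snoc_last, Fin.snoc_castSucc,
    wbarC_mul_const_add, wderC_mul_const_add, wbarC_mul_conj_add_sq]
  refine ⟨fun _ => trivial, ?_, fun α => ?_, trivial⟩
  · have h := sum_antisymm_mul_mul_eq_zero A hA fun α => conj (u α)
    have h' : ∑ α, ∑ β, A α β * conj (ζ * u β + 0) * conj (u α) =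
        conj ζ * ∑ α, ∑ β, A α β * conj (u β) * conj (u α) := by
      simp only [Finset.mul_sum]
      refine Finset.sum_congr rfl fun α _ => Finset.sum_congr rfl fun β _ => ?_
      simp only [add_zero, map_mul]
      ring
    rw [h', h]
    ring
  · have h : ∑ β, conj (A α β) * (ζ * u β + 0) * conj (1 : ℂ) =
        ζ * ∑ β, conj (A α β) * u β := by
      rw [Finset.mul_sum]
      refine Finset.sum_congr rfl fun β _ => ?_
      simp only [add_zero, map_one]
      ring
    rw [h]
    ring

theorem bdrySystem_linearDisc {n : ℕ} (A : Fin n → Fin n → ℂ) (u : Fin n → ℂ) {s : ℝ}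
    (hu : ∑ α, normSq (u α) = 2 * s) {ζ : ℂ} (hζ : conj ζ * ζ = 1) :
    bdrySystem n A (linearDisc u s) (linearDiscLift A u) ζ := by
  have hn : normSq ζ = 1 := by
    rw [mul_comm, mul_conj] at hζ
    exact_mod_cast hζ
  simp only [bdrySystem, linearDisc, linearDiscLift, Fin.snoc_last, Fin.snoc_castSucc]
  refine ⟨?_, fun α => ?_, ?_⟩
  · simp [hn, hu]
  · have h : ∑ β, conj (A α β) * (ζ * u β + 0) = ζ * ∑ β, conj (A α β) * u β := by
      rw [Finset.mul_sum]
      refine Finset.sum_congr rfl fun β _ => ?_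
      ring
    rw [h]
    simp only [add_zero, map_mul, mul_one]
    linear_combination (conj (u α) - I * ∑ β, conj (A α β) * u β) * hζ
  · simp only [mul_one, add_zero]
    ring

theorem hasFDerivAt_linearDisc {n : ℕ} (u : Fin n → ℂ) (s ζ : ℂ) :
    HasFDerivAt (𝕜 := ℝ) (linearDisc u s)
      (ContinuousLinearMap.pi fun i =>
        (Fin.snoc u 0 : Fin (n + 1) → ℂ) i • ContinuousLinearMap.id ℝ ℂ) ζ := by
  refine hasFDerivAt_pi.mpr fun i => ?_
  cases i using Fin.lastCases <;> simp only [linearDisc, Fin.snoc_last, Fin.snoc_castSucc] <;>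
    exact hasFDerivAt_mul_const_add _ _ ζ

/-- through every point `(0,…,0,s)`, `s > 0`, of the inward real normal axis
of `Γ⁰`, and tangent to every nonzero direction `v ∈ ℂ^{n−1}×{0}`, there passes a
stationary disc of `Γ⁰` for the osculating structure `J⁰`. -/
theorem stmt15 (n : ℕ) (hn : 1 ≤ n) (A : Fin n → Fin n → ℂ)
    (hA : ∀ α β, A α β = - A β α)
    (s : ℝ) (hs : 0 < s)
    (v : Fin (n+1) → ℂ) (hv : v ≠ 0) (hvtan : v (Fin.last n) = 0) :
    ∃ f g : ℂ → Fin (n+1) → ℂ,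
      ContinuousOn f (Metric.closedBall (0:ℂ) 1) ∧
      ContinuousOn g (Metric.closedBall (0:ℂ) 1) ∧
      ContDiffOn ℝ 1 f (Metric.ball (0:ℂ) 1) ∧
      ContDiffOn ℝ 1 g (Metric.ball (0:ℂ) 1) ∧
      (∀ ζ ∈ Metric.ball (0:ℂ) 1, starSystem n A f g ζ) ∧
      (∀ ζ ∈ Metric.sphere (0:ℂ) 1,
        bdrySystem n A f g ζ ∧
        (conj ζ * g ζ (Fin.last n)).im = 0 ∧ conj ζ * g ζ (Fin.last n) ≠ 0) ∧
      f 0 = Pi.single (Fin.last n) (s : ℂ) ∧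
      (∃ c : ℝ, c ≠ 0 ∧ fderiv ℝ f 0 1 = c • v) := by
  obtain ⟨c, hc, hcs⟩ := exists_ne_zero_mul_sum_normSq_eq hs hv hvtan
  set u : Fin n → ℂ := fun α => c * v α.castSucc with hu_def
  have hu : ∑ α, normSq (u α) = 2 * s := by
    simp only [hu_def, normSq_mul, normSq_ofReal, ← Finset.mul_sum, ← pow_two, hcs]
  refine ⟨linearDisc u s, linearDiscLift A u,
    (contDiff_linearDisc u s).continuous.continuousOn,
    (contDiff_linearDiscLift A u).continuous.continuousOn,
    (contDiff_linearDisc u s).contDiffOn, (contDiff_linearDiscLift A u).contDiffOn,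
    fun ζ _ => starSystem_linearDisc A hA u s ζ, fun ζ hζ => ?_, ?_, c, hc, ?_⟩
  · have hζ' : conj ζ * ζ = 1 := by
      rw [conj_mul', mem_sphere_zero_iff_norm.mp hζ]
      norm_num
    have hg : conj ζ * linearDiscLift A u ζ (Fin.last n) = 1 := by
      simpa [linearDiscLift] using hζ'
    exact ⟨bdrySystem_linearDisc A u hu hζ', by simp [hg], by simp [hg]⟩
  · funext i
    cases i using Fin.lastCases <;> simp [linearDisc]
  · rw [(hasFDerivAt_linearDisc u s 0).fderiv]
    funext i
    cases i using Fin.lastCases <;> simp [hu_def, hvtan]
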